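/- arXiv:1107.2427 — 4 statements merged into one kernel-verified Lean document; each statement's English description precedes it below -/
import Mathlib

section
/- Assume the parameters are such that d_k² > 0 and the values R_k^{α,β}(0)_q, R_k^{α,β}(N)_q are real for 0 ≤ k ≤ n−1. Then for all real A > 0 and B > 0, one has κ_{n−1}(0,N) ≥ 1 > 0; in particular κ_{n−1}(0,N) ≠ 0, so the q-Racah–Krall polynomials are well defined for all A, B > 0. -/
open Finset Filter

set_option autoImplicit false

noncomputable section

/-- The `q`-Pochhammer symbol `(a;q)_k = ∏_{i=0}^{k-1} (1 - a q^i)`. -/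
def qPoch (a q : ℂ) (k : ℕ) : ℂ := ∏ i ∈ Finset.range k, (1 - a * q ^ i)

/-- The lattice `x(s) = q^{-s} + δ γ q^{s+1}`. -/
def qLat (q γ δ : ℂ) (s : ℤ) : ℂ := q ^ (-s) + δ * γ * q ^ (s + 1)

/-- The standard (monic-normalized as in the paper) `q`-Racah polynomial
`R_n^{α,β}(s)_q` evaluated at an integer lattice point `s`. -/
def qRacah (q α β γ δ : ℂ) (n : ℕ) (s : ℤ) : ℂ :=
  (qPoch (α * q) q n * qPoch (β * δ * q) q n * qPoch (γ * q) q n /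
      qPoch (α * β * q ^ ((n : ℤ) + 1)) q n) *
    ∑ k ∈ Finset.range (n + 1),
      qPoch (q ^ (-(n : ℤ))) q k * qPoch (α * β * q ^ ((n : ℤ) + 1)) q k *
          qPoch (q ^ (-s)) q k * qPoch (δ * γ * q ^ (s + 1)) q k /
        (qPoch (α * q) q k * qPoch (β * δ * q) q k * qPoch (γ * q) q k * qPoch q q k) *
        q ^ k

/-- The squared norm `d_n²` of the standard `q`-Racah polynomials. -/
def qRacahNormSq (q α β γ δ : ℂ) (n : ℕ) : ℂ :=
  (1 - α * β * q) * (δ * γ * q) ^ n / (1 - α * β * q ^ (2 * (n : ℤ) + 1)) *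
    (qPoch (α * q) q n * qPoch (β * δ * q) q n * qPoch (γ * q) q n * qPoch q q n *
      qPoch (q * α * β * γ⁻¹) q n * qPoch (α * δ⁻¹ * q) q n * qPoch (β * q) q n) /
    (qPoch (α * β * q) q n * qPoch (α * β * q ^ ((n : ℤ) + 1)) q n *
      qPoch (α * β * q ^ ((n : ℤ) + 1)) q n)

/-- The kernel `K_{n-1}^{α,β}(s,t) = ∑_{k=0}^{n-1} R_k(s) R_k(t) / d_k²`
(the index `n` here denotes the number of summands, so `qKer q α β γ δ n = K_{n-1}`). -/
def qKer (q α β γ δ : ℂ) (n : ℕ) (s t : ℤ) : ℂ :=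
  ∑ k ∈ Finset.range n,
    qRacah q α β γ δ k s * qRacah q α β γ δ k t / qRacahNormSq q α β γ δ k

/-- `κ_{n-1}(s,t)` (with the same index convention as `qKer`). -/
def qKappa (q α β γ δ A B : ℂ) (n : ℕ) (s t : ℤ) : ℂ :=
  1 + A * qKer q α β γ δ n s s + B * qKer q α β γ δ n t t +
    A * B * (qKer q α β γ δ n s s * qKer q α β γ δ n t t - (qKer q α β γ δ n s t) ^ 2)

/-- The value `R_n^{α,β,A,B}(0)_q` of the `q`-Racah–Krall polynomial at `s = 0`. -/
def qKrall0 (q α β γ δ A B : ℂ) (N n : ℕ) : ℂ :=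
  ((1 + B * qKer q α β γ δ n N N) * qRacah q α β γ δ n 0 -
      B * qKer q α β γ δ n 0 N * qRacah q α β γ δ n N) / qKappa q α β γ δ A B n 0 N

/-- The value `R_n^{α,β,A,B}(N)_q` of the `q`-Racah–Krall polynomial at `s = N`. -/
def qKrallN (q α β γ δ A B : ℂ) (N n : ℕ) : ℂ :=
  (-(A * qKer q α β γ δ n N 0 * qRacah q α β γ δ n 0) +
      (1 + A * qKer q α β γ δ n 0 0) * qRacah q α β γ δ n N) / qKappa q α β γ δ A B n 0 N

/-- The `q`-Racah–Krall polynomial `R_n^{α,β,A,B}(s)_q`. -/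
def qRacahKrall (q α β γ δ A B : ℂ) (N n : ℕ) (s : ℤ) : ℂ :=
  qRacah q α β γ δ n s - A * qKrall0 q α β γ δ A B N n * qKer q α β γ δ n s 0 -
    B * qKrallN q α β γ δ A B N n * qKer q α β γ δ n s N

/-- Weighted Cauchy–Schwarz: `1 + A K(s,s) + B K(t,t) + A B (K(s,s) K(t,t) - K(s,t)²) ≥ 1` for
a finite kernel `K` with positive weights and nonnegative masses `A, B`. -/
theorem one_le_kernel_gram_form {ι : Type*} (I : Finset ι) (u v d : ι → ℝ)
    (hd : ∀ k ∈ I, 0 < d k) {A B : ℝ} (hA : 0 ≤ A) (hB : 0 ≤ B) :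
    1 ≤ 1 + A * ∑ k ∈ I, u k * u k / d k + B * ∑ k ∈ I, v k * v k / d k +
      A * B * ((∑ k ∈ I, u k * u k / d k) * (∑ k ∈ I, v k * v k / d k) -
        (∑ k ∈ I, u k * v k / d k) ^ 2) := by
  have hu : ∀ k ∈ I, 0 ≤ u k * u k / d k := fun k hk =>
    div_nonneg (mul_self_nonneg _) (hd k hk).le
  have hv : ∀ k ∈ I, 0 ≤ v k * v k / d k := fun k hk =>
    div_nonneg (mul_self_nonneg _) (hd k hk).le
  have hcs : (∑ k ∈ I, u k * v k / d k) ^ 2 ≤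
      (∑ k ∈ I, u k * u k / d k) * ∑ k ∈ I, v k * v k / d k :=
    Finset.sum_sq_le_sum_mul_sum_of_sq_le_mul I hu hv fun k _ => le_of_eq (by ring)
  have hU := mul_nonneg hA (Finset.sum_nonneg hu)
  have hV := mul_nonneg hB (Finset.sum_nonneg hv)
  have hUV := mul_nonneg (mul_nonneg hA hB) (sub_nonneg.mpr hcs)
  linarith

/-- If the summands' ingredients are real, the kernel is the coercion of a real sum. -/
theorem qKer_eq_ofReal {q α β γ δ : ℂ} {n : ℕ} {s t : ℤ}
    (hd : ∀ k < n, (qRacahNormSq q α β γ δ k).im = 0)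
    (hs : ∀ k < n, (qRacah q α β γ δ k s).im = 0)
    (ht : ∀ k < n, (qRacah q α β γ δ k t).im = 0) :
    qKer q α β γ δ n s t = ((∑ k ∈ Finset.range n,
      (qRacah q α β γ δ k s).re * (qRacah q α β γ δ k t).re /
        (qRacahNormSq q α β γ δ k).re : ℝ) : ℂ) := by
  have ofReal_re {z : ℂ} (hz : z.im = 0) : ((z.re : ℝ) : ℂ) = z :=
    Complex.ext (by simp) (by simp [hz])
  unfold qKer
  push_cast
  refine Finset.sum_congr rfl fun k hk => ?_
  have hk := Finset.mem_range.mp hk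
  rw [ofReal_re (hd k hk), ofReal_re (hs k hk), ofReal_re (ht k hk)]

/-- for positive masses `A, B` the quantity `κ_{n-1}(0,N)` is a real
number `≥ 1`; in particular it is nonzero, so the q-Racah–Krall polynomials are
well defined for all `A, B > 0`. -/
theorem qKappa_ge_one_of_pos_masses
    (q : ℝ) (hq0 : 0 < q) (hq1 : q < 1) (α β γ δ : ℂ) (N : ℕ)
    (htrunc : α * (q : ℂ) = (q : ℂ) ^ (-(N : ℤ)) ∨ β * δ * (q : ℂ) = (q : ℂ) ^ (-(N : ℤ)) ∨
      γ * (q : ℂ) = (q : ℂ) ^ (-(N : ℤ)))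
    (n : ℕ) (hn1 : 1 ≤ n) (hnN : n ≤ N)
    (hnorm : ∀ k : ℕ, k < n → (qRacahNormSq (q : ℂ) α β γ δ k).im = 0 ∧
      0 < (qRacahNormSq (q : ℂ) α β γ δ k).re)
    (hreal : ∀ k : ℕ, k < n → (qRacah (q : ℂ) α β γ δ k 0).im = 0 ∧
      (qRacah (q : ℂ) α β γ δ k (N : ℤ)).im = 0)
    (A B : ℝ) (hA : 0 < A) (hB : 0 < B) :
    1 ≤ (qKappa (q : ℂ) α β γ δ (A : ℂ) (B : ℂ) n 0 (N : ℤ)).re ∧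
      (qKappa (q : ℂ) α β γ δ (A : ℂ) (B : ℂ) n 0 (N : ℤ)).im = 0 ∧
      qKappa (q : ℂ) α β γ δ (A : ℂ) (B : ℂ) n 0 (N : ℤ) ≠ 0 := by
  have hd := fun k hk => (hnorm k hk).1
  have h0 := fun k hk => (hreal k hk).1
  have hN := fun k hk => (hreal k hk).2
  have hge := one_le_kernel_gram_form (Finset.range n)
    (fun k => (qRacah (q : ℂ) α β γ δ k 0).re) (fun k => (qRacah (q : ℂ) α β γ δ k (N : ℤ)).re)
    (fun k => (qRacahNormSq (q : ℂ) α β γ δ k).re)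
    (fun k hk => (hnorm k (Finset.mem_range.mp hk)).2) hA.le hB.le
  unfold qKappa
  rw [qKer_eq_ofReal hd h0 h0, qKer_eq_ofReal hd hN hN, qKer_eq_ofReal hd h0 hN]
  norm_cast
  exact ⟨hge, rfl, (zero_lt_one.trans_le hge).ne'⟩
end
end

section
/- Assume ρ : {0,…,N} → ℝ satisfies the orthogonality relation Σ_{s=0}^{N} R_n^{α,β}(s)_q R_m^{α,β}(s)_q ρ(s) Δx(s−1/2) = δ_{n,m} d_n² for all 0 ≤ n, m ≤ N, where Δx(s−1/2) = x(s+1/2) − x(s−1/2). Then for all 0 ≤ n, m ≤ N the q-Racah–Krall polynomials satisfy Σ_{s=0}^{N} R_n^{α,β,A,B}(s)_q R_m^{α,β,A,B}(s)_q ρ(s) Δx(s−1/2) + A R_n^{α,β,A,B}(0)_q R_m^{α,β,A,B}(0)_q + B R_n^{α,β,A,B}(N)_q R_m^{α,β,A,B}(N)_q = δ_{n,m} d̃_n², where d̃_n² = d_n² + [ A (R_n^{α,β}(0)_q)² (1 + B K_{n−1}^{α,β}(N,N)) + B (R_n^{α,β}(N)_q)² (1 + A K_{n−1}^{α,β}(0,0))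 − 2AB R_n^{α,β}(0)_q R_n^{α,β}(N)_q K_{n−1}^{α,β}(0,N) ] / κ_{n−1}(0,N). -/
open Finset Filter

set_option autoImplicit false

noncomputable section

/-- `Δx(s - 1/2) = x(s + 1/2) - x(s - 1/2)` for the lattice `x(s) = q^{-s} + δγq^{s+1}`. -/
def qDx (q : ℝ) (γ δ : ℂ) (s : ℕ) : ℂ :=
  (((q ^ (-(s : ℝ) - 1 / 2) : ℝ)) : ℂ) + δ * γ * (((q ^ ((s : ℝ) + 3 / 2) : ℝ)) : ℂ) -
    ((((q ^ (-(s : ℝ) + 1 / 2) : ℝ)) : ℂ) + δ * γ * (((q ^ ((s : ℝ) + 1 / 2) : ℝ)) : ℂ))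

section Uvarov

variable {F X : Type*} [Field F]

/-- The Christoffel–Darboux kernel with `n` summands of a family `P` with squared norms `d`. -/
def cdKernel (P : ℕ → X → F) (d : ℕ → F) (n : ℕ) (s t : X) : F :=
  ∑ k ∈ Finset.range n, P k s * P k t / d k

/-- The modification of `P n` by the kernels at `a` and `b`, with coefficients `u` and `v`. -/
def uvarovMod (P : ℕ → X → F) (d : ℕ → F) (a b : X) (u v : ℕ → F) (n : ℕ) (s : X) : F :=
  P n s - u n * cdKernel P d n s a - v n * cdKernel P d n s b

theorem cdKernel_comm (P : ℕ → X → F) (d : ℕ → F) (n : ℕ) (s t : X) :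
    cdKernel P d n s t = cdKernel P d n t s := by
  simp only [cdKernel, mul_comm (P _ s)]

theorem map_mul_cdKernel (L : (X → F) →ₗ[F] F) (P : ℕ → X → F) (d : ℕ → F) (g : X → F)
    (n : ℕ) (t : X) :
    L (g * fun s => cdKernel P d n s t) =
      ∑ k ∈ Finset.range n, L (g * P k) * P k t / d k := by
  have h : (g * fun s => cdKernel P d n s t) =
      ∑ k ∈ Finset.range n, (P k t / d k) • (g * P k) := by
    ext s
    simp only [cdKernel, Pi.mul_apply, Finset.sum_apply, Pi.smul_apply, smul_eq_mul,
      Finset.mul_sum]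
    exact Finset.sum_congr rfl fun k _ => by ring
  rw [h, map_sum]
  exact Finset.sum_congr rfl fun k _ => by rw [map_smul, smul_eq_mul]; ring

theorem map_mul_uvarovMod (L : (X → F) →ₗ[F] F) (P : ℕ → X → F) (d : ℕ → F) (a b : X)
    (u v : ℕ → F) (g : X → F) (n : ℕ) :
    L (g * uvarovMod P d a b u v n) = L (g * P n) -
      u n * ∑ k ∈ Finset.range n, L (g * P k) * P k a / d k -
      v n * ∑ k ∈ Finset.range n, L (g * P k) * P k b / d k := by
  have h : g * uvarovMod P d a b u v n = g * P n -
      u n • (g * fun s => cdKernel P d n s a) - v n • (g * fun s => cdKernel P d n s b) := by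
    ext s
    simp only [uvarovMod, Pi.mul_apply, Pi.sub_apply, Pi.smul_apply, smul_eq_mul]
    ring
  rw [h, map_sub, map_sub, map_smul, map_smul, map_mul_cdKernel, map_mul_cdKernel,
    smul_eq_mul, smul_eq_mul]

variable {L : (X → F) →ₗ[F] F} {P : ℕ → X → F} {d : ℕ → F} {N : ℕ}

theorem map_uvarovMod_mul_of_le (hd : ∀ k ≤ N, d k ≠ 0)
    (hL : ∀ n m, n ≤ N → m ≤ N → L (P n * P m) = if n = m then d n else 0)
    (a b : X) (u v : ℕ → F) {n j : ℕ} (hn : n ≤ N) (hj : j ≤ n) :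
    L (uvarovMod P d a b u v n * P j) =
      if n = j then d n else -(u n * P j a) - v n * P j b := by
  have key : ∀ t, ∑ k ∈ Finset.range n, L (P j * P k) * P k t / d k =
      if n = j then 0 else P j t := by
    intro t
    have hsum : ∀ k ∈ Finset.range n, L (P j * P k) * P k t / d k =
        if j = k then P j t else 0 := by
      intro k hk
      have hk' := Finset.mem_range.1 hk
      rw [hL j k (hj.trans hn) (hk'.le.trans hn)]
      split_ifs with h
      · subst h
        rw [mul_div_assoc, mul_div_cancel₀ _ (hd j (hj.trans hn))]
      · simp
    rw [Finset.sum_congr rfl hsum, Finset.sum_ite_eq]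
    by_cases h : n = j
    · simp [h]
    · simp [h, lt_of_le_of_ne hj (Ne.symm h)]
  rw [mul_comm, map_mul_uvarovMod, key, key, mul_comm (P j), hL n j hn (hj.trans hn)]
  split_ifs <;> ring

theorem map_uvarovMod_mul_uvarovMod_of_le (hd : ∀ k ≤ N, d k ≠ 0)
    (hL : ∀ n m, n ≤ N → m ≤ N → L (P n * P m) = if n = m then d n else 0)
    (a b : X) (u v : ℕ → F) {n m : ℕ} (hn : n ≤ N) (hm : m ≤ n) :
    L (uvarovMod P d a b u v n * uvarovMod P d a b u v m) =
      (if n = m then d n + u n * P n a + v n * P n b else 0) -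
        u n * uvarovMod P d a b u v m a - v n * uvarovMod P d a b u v m b := by
  have key : ∀ t, ∑ k ∈ Finset.range m,
      L (uvarovMod P d a b u v n * P k) * P k t / d k =
        -(u n * cdKernel P d m a t) - v n * cdKernel P d m b t := by
    intro t
    rw [cdKernel, cdKernel, Finset.mul_sum, Finset.mul_sum, ← Finset.sum_neg_distrib,
      ← Finset.sum_sub_distrib]
    refine Finset.sum_congr rfl fun k hk => ?_
    have hk' := Finset.mem_range.1 hk
    rw [map_uvarovMod_mul_of_le hd hL a b u v hn (by omega), if_neg (by omega)]
    ring
  rw [map_mul_uvarovMod, key, key, map_uvarovMod_mul_of_le hd hL a b u v hn hm]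
  simp only [uvarovMod]
  rw [cdKernel_comm P d m b a]
  split_ifs with h
  · subst h
    ring
  · ring

/-- Adding the point masses `A` at `a` and `B` at `b` preserves orthogonality. -/
theorem uvarovMod_orthogonality (hd : ∀ k ≤ N, d k ≠ 0)
    (hL : ∀ n m, n ≤ N → m ≤ N → L (P n * P m) = if n = m then d n else 0)
    (a b : X) (A B : F) (c e : ℕ → F)
    (hc : ∀ n ≤ N, uvarovMod P d a b (fun k => A * c k) (fun k => B * e k) n a = c n)
    (he : ∀ n ≤ N, uvarovMod P d a b (fun k => A * c k) (fun k => B * e k) n b = e n)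
    {n m : ℕ} (hn : n ≤ N) (hm : m ≤ N) :
    L (uvarovMod P d a b (fun k => A * c k) (fun k => B * e k) n *
        uvarovMod P d a b (fun k => A * c k) (fun k => B * e k) m) +
      A * c n * c m + B * e n * e m =
      if n = m then d n + A * c n * P n a + B * e n * P n b else 0 := by
  wlog hmn : m ≤ n generalizing n m
  · have h := this hm hn (le_of_not_ge hmn)
    rw [if_neg (by omega)] at h ⊢
    rw [mul_comm, ← h]
    ring
  rw [map_uvarovMod_mul_uvarovMod_of_le hd hL _ _ _ _ hn hmn, hc m hm, he m hm]
  ring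

end Uvarov

theorem qKer_comm (q α β γ δ : ℂ) (n : ℕ) (s t : ℤ) :
    qKer q α β γ δ n s t = qKer q α β γ δ n t s :=
  cdKernel_comm (qRacah q α β γ δ) (qRacahNormSq q α β γ δ) n s t

theorem qRacahKrall_zero {q α β γ δ A B : ℂ} {N n : ℕ}
    (hκ : qKappa q α β γ δ A B n 0 N ≠ 0) :
    qRacahKrall q α β γ δ A B N n 0 = qKrall0 q α β γ δ A B N n := by
  rw [qRacahKrall, qKrallN, qKrall0, qKer_comm q α β γ δ n N 0]
  field_simp
  rw [qKappa]
  ring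

theorem qRacahKrall_natCast {q α β γ δ A B : ℂ} {N n : ℕ}
    (hκ : qKappa q α β γ δ A B n 0 N ≠ 0) :
    qRacahKrall q α β γ δ A B N n N = qKrallN q α β γ δ A B N n := by
  rw [qRacahKrall, qKrallN, qKrall0, qKer_comm q α β γ δ n N 0]
  field_simp
  rw [qKappa]
  ring

/-- the q-Racah–Krall polynomials satisfy the modified orthogonality
relation with squared norms `d̃_n²`. -/
theorem qRacahKrall_orthogonality
    (q : ℝ) (hq0 : 0 < q) (hq1 : q < 1) (α β γ δ : ℂ) (N : ℕ)
    (htrunc : α * (q : ℂ) = (q : ℂ) ^ (-(N : ℤ)) ∨ β * δ * (q : ℂ) = (q : ℂ) ^ (-(N : ℤ)) ∨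
      γ * (q : ℂ) = (q : ℂ) ^ (-(N : ℤ)))
    (A B : ℂ) (ρ : ℕ → ℝ)
    (hnorm : ∀ k : ℕ, k ≤ N → qRacahNormSq (q : ℂ) α β γ δ k ≠ 0)
    (hκ : ∀ k : ℕ, k ≤ N → qKappa (q : ℂ) α β γ δ A B k 0 (N : ℤ) ≠ 0)
    (hortho : ∀ n m : ℕ, n ≤ N → m ≤ N →
      ∑ s ∈ Finset.range (N + 1),
          qRacah (q : ℂ) α β γ δ n (s : ℤ) * qRacah (q : ℂ) α β γ δ m (s : ℤ) *
            ((ρ s : ℝ) : ℂ) * qDx q γ δ s =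
        if n = m then qRacahNormSq (q : ℂ) α β γ δ n else 0) :
    ∀ n m : ℕ, n ≤ N → m ≤ N →
      ∑ s ∈ Finset.range (N + 1),
          qRacahKrall (q : ℂ) α β γ δ A B N n (s : ℤ) *
            qRacahKrall (q : ℂ) α β γ δ A B N m (s : ℤ) * ((ρ s : ℝ) : ℂ) * qDx q γ δ s +
        A * qRacahKrall (q : ℂ) α β γ δ A B N n 0 * qRacahKrall (q : ℂ) α β γ δ A B N m 0 +
        B * qRacahKrall (q : ℂ) α β γ δ A B N n (N : ℤ) *
          qRacahKrall (q : ℂ) α β γ δ A B N m (N : ℤ) =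
      if n = m then
        qRacahNormSq (q : ℂ) α β γ δ n +
          (A * (qRacah (q : ℂ) α β γ δ n 0) ^ 2 *
              (1 + B * qKer (q : ℂ) α β γ δ n (N : ℤ) (N : ℤ)) +
            B * (qRacah (q : ℂ) α β γ δ n (N : ℤ)) ^ 2 *
              (1 + A * qKer (q : ℂ) α β γ δ n 0 0) -
            2 * A * B * qRacah (q : ℂ) α β γ δ n 0 * qRacah (q : ℂ) α β γ δ n (N : ℤ) *
              qKer (q : ℂ) α β γ δ n 0 (N : ℤ)) /
            qKappa (q : ℂ) α β γ δ A B n 0 (N : ℤ)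
      else 0 := by
  intro n m hn hm
  let L : (ℤ → ℂ) →ₗ[ℂ] ℂ :=
    ∑ s ∈ Finset.range (N + 1), (((ρ s : ℝ) : ℂ) * qDx q γ δ s) • LinearMap.proj (s : ℤ)
  have hLapply : ∀ f g : ℤ → ℂ, L (f * g) = ∑ s ∈ Finset.range (N + 1),
      f (s : ℤ) * g (s : ℤ) * ((ρ s : ℝ) : ℂ) * qDx q γ δ s := by
    intro f g
    simp only [L, LinearMap.sum_apply, LinearMap.smul_apply, LinearMap.proj_apply,
      Pi.mul_apply, smul_eq_mul]
    exact Finset.sum_congr rfl fun s _ => by ring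
  have h := uvarovMod_orthogonality (L := L) hnorm
    (fun n m hn hm => (hLapply _ _).trans (hortho n m hn hm)) (0 : ℤ) (N : ℤ) A B
    (qKrall0 q α β γ δ A B N) (qKrallN q α β γ δ A B N)
    (fun k hk => qRacahKrall_zero (hκ k hk)) (fun k hk => qRacahKrall_natCast (hκ k hk)) hn hm
  rw [hLapply] at h
  rw [qRacahKrall_zero (hκ n hn), qRacahKrall_zero (hκ m hm), qRacahKrall_natCast (hκ n hn),
    qRacahKrall_natCast (hκ m hm)]
  refine h.trans ?_
  congr 1
  rw [qKrall0, qKrallN, qKer_comm _ α β γ δ n N 0]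
  ring
end
end

section
/- For every integer n with 1 ≤ n ≤ N and every s, the q-Racah–Krall polynomial satisfies the second representation formula φ(s) R_n^{α,β,A,B}(s)_q = A(s,n) R_n^{α,β}(s)_q + B(s,n) R_{n−1}^{α,β}(s)_q, where φ(s) = (1 − δγq^{N+1}q^s)(1 − δγq^{s+1})(q^{−s} − 1)(q^{−s} − q^{−N}), A(s,n) = φ(s) − (1/d_{n−1}²)[ A R_n^{α,β,A,B}(0)_q R_{n−1}^{α,β}(0)_q (q^{−s} − q^{−N})(1 − δγq^{N+1}q^s) + B R_n^{α,β,A,B}(N)_q R_{n−1}^{α,β}(N)_q (1 − δγq^{s+1})(q^{−s} − 1) ], and B(s,n) = (1/d_{n−1}²)[ A R_n^{α,β,A,B}(0)_q R_n^{α,β}(0)_q (q^{−s} − q^{−N})(1 − δγq^{N+1}q^s) + B R_n^{α,β,A,B}(N)_q R_n^{α,β}(N)_q (1 − δγq^{s+1})(q^{−s} − 1) ]. -/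
open Finset Filter

set_option autoImplicit false

noncomputable section

/-- `φ(s) = (1 - δγq^{N+1}q^s)(1 - δγq^{s+1})(q^{-s} - 1)(q^{-s} - q^{-N})`. -/
def qPhi (q γ δ : ℂ) (N : ℕ) (s : ℤ) : ℂ :=
  (1 - δ * γ * q ^ ((N : ℤ) + 1) * q ^ s) * (1 - δ * γ * q ^ (s + 1)) * (q ^ (-s) - 1) *
    (q ^ (-s) - q ^ (-(N : ℤ)))

/-- The coefficient `A(s,n)` in the second representation formula. -/
def qRepA (q α β γ δ A B : ℂ) (N n : ℕ) (s : ℤ) : ℂ :=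
  qPhi q γ δ N s -
    1 / qRacahNormSq q α β γ δ (n - 1) *
      (A * qKrall0 q α β γ δ A B N n * qRacah q α β γ δ (n - 1) 0 *
          ((q ^ (-s) - q ^ (-(N : ℤ))) * (1 - δ * γ * q ^ ((N : ℤ) + 1) * q ^ s)) +
        B * qKrallN q α β γ δ A B N n * qRacah q α β γ δ (n - 1) (N : ℤ) *
          ((1 - δ * γ * q ^ (s + 1)) * (q ^ (-s) - 1)))

/-- The coefficient `B(s,n)` in the second representation formula. -/
def qRepB (q α β γ δ A B : ℂ) (N n : ℕ) (s : ℤ) : ℂ :=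
  1 / qRacahNormSq q α β γ δ (n - 1) *
    (A * qKrall0 q α β γ δ A B N n * qRacah q α β γ δ n 0 *
        ((q ^ (-s) - q ^ (-(N : ℤ))) * (1 - δ * γ * q ^ ((N : ℤ) + 1) * q ^ s)) +
      B * qKrallN q α β γ δ A B N n * qRacah q α β γ δ n (N : ℤ) *
        ((1 - δ * γ * q ^ (s + 1)) * (q ^ (-s) - 1)))

lemma qPoch_zero (a q : ℂ) : qPoch a q 0 = 1 := by simp [qPoch]

lemma qPoch_succ (a q : ℂ) (k : ℕ) :
    qPoch a q (k + 1) = qPoch a q k * (1 - a * q ^ k) := by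
  simp [qPoch, Finset.prod_range_succ]

lemma qPoch_succ' (a q : ℂ) (k : ℕ) :
    qPoch a q (k + 1) = (1 - a) * qPoch (a * q) q k := by
  simp only [qPoch, Finset.prod_range_succ', pow_zero, mul_one]
  rw [mul_comm]
  congr 1
  exact Finset.prod_congr rfl fun i _ => by ring

lemma qPoch_inv_pow_eq_zero {q : ℂ} (hq : q ≠ 0) (n : ℕ) : qPoch (q ^ n)⁻¹ q (n + 1) = 0 := by
  rw [qPoch_succ, inv_mul_cancel₀ (pow_ne_zero n hq), sub_self, mul_zero]

/-- The prefactor normalizing the basic hypergeometric sum to a monic polynomial. -/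
def qRacahPrefactor (q α β γ δ : ℂ) (n : ℕ) : ℂ :=
  qPoch (α * q) q n * qPoch (β * δ * q) q n * qPoch (γ * q) q n / qPoch (α * β * q ^ (n + 1)) q n

/-- The part of the `k`-th hypergeometric coefficient depending on the degree `n`. -/
def qRacahCoeff (q M : ℂ) (n k : ℕ) : ℂ := qPoch (q ^ n)⁻¹ q k * qPoch (M * q ^ (n + 1)) q k

/-- The part of the `k`-th hypergeometric term depending on the lattice point `s`. -/
def qRacahBasis (q α β γ δ : ℂ) (s : ℤ) (k : ℕ) : ℂ :=
  qPoch (q ^ (-s)) q k * qPoch (δ * γ * q ^ (s + 1)) q k /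
    (qPoch (α * q) q k * qPoch (β * δ * q) q k * qPoch (γ * q) q k * qPoch q q k) * q ^ k

/-- The basic hypergeometric sum `₄φ₃` underlying the `q`-Racah polynomial. -/
def qRacahSum (q α β γ δ : ℂ) (n : ℕ) (s : ℤ) : ℂ :=
  ∑ k ∈ Finset.range (n + 1), qRacahCoeff q (α * β) n k * qRacahBasis q α β γ δ s k

/-- The raising coefficient of the three-term recurrence. -/
def qRacahRaise (q α β γ δ : ℂ) (n : ℕ) : ℂ :=
  (1 - α * q ^ (n + 1)) * (1 - α * β * q ^ (n + 1)) * (1 - β * δ * q ^ (n + 1)) *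
      (1 - γ * q ^ (n + 1)) /
    ((1 - α * β * q ^ (2 * n + 1)) * (1 - α * β * q ^ (2 * n + 2)))

/-- The lowering coefficient of the three-term recurrence. -/
def qRacahLower (q α β γ δ : ℂ) (n : ℕ) : ℂ :=
  q * (1 - q ^ n) * (1 - β * q ^ n) * (γ - α * β * q ^ n) * (δ - α * q ^ n) /
    ((1 - α * β * q ^ (2 * n)) * (1 - α * β * q ^ (2 * n + 1)))

lemma qRacah_eq_prefactor_mul_sum (q α β γ δ : ℂ) (n : ℕ) (s : ℤ) :
    qRacah q α β γ δ n s = qRacahPrefactor q α β γ δ n * qRacahSum q α β γ δ n s := by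
  have h : q ^ ((n : ℤ) + 1) = q ^ (n + 1) := by norm_cast
  simp only [qRacah, qRacahPrefactor, qRacahSum, qRacahCoeff, qRacahBasis, h, zpow_neg,
    zpow_natCast]
  congr 1
  exact Finset.sum_congr rfl fun k _ => by ring

lemma qRacahCoeff_zero (q M : ℂ) (n : ℕ) : qRacahCoeff q M n 0 = 1 := by
  simp [qRacahCoeff, qPoch_zero]

lemma qRacahCoeff_succ (q M : ℂ) (n k : ℕ) :
    qRacahCoeff q M n (k + 1) =
      qRacahCoeff q M n k * ((1 - (q ^ n)⁻¹ * q ^ k) * (1 - M * q ^ (n + 1) * q ^ k)) := by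
  simp only [qRacahCoeff, qPoch_succ]
  ring

lemma qRacahCoeff_eq_zero {q : ℂ} (hq : q ≠ 0) (M : ℂ) (n : ℕ) :
    qRacahCoeff q M n (n + 1) = 0 := by
  rw [qRacahCoeff, qPoch_inv_pow_eq_zero hq, zero_mul]

lemma qRacahCoeff_succ_sub {q : ℂ} (hq : q ≠ 0) (M : ℂ) (n j : ℕ) :
    qRacahCoeff q M (n + 1) (j + 1) - qRacahCoeff q M n (j + 1) =
      -(q ^ (n + 1))⁻¹ * (1 - q ^ (j + 1)) * (1 - M * q ^ (2 * n + 2)) *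
        (qPoch (q ^ n)⁻¹ q j * qPoch (M * q ^ (n + 2)) q j) := by
  have h : (q ^ (n + 1))⁻¹ * q = (q ^ n)⁻¹ := by
    rw [pow_succ]; field_simp
  have hM : M * q ^ (n + 1) * q = M * q ^ (n + 2) := by ring
  have hqn := pow_ne_zero n hq
  simp only [qRacahCoeff]
  rw [qPoch_succ' (q ^ (n + 1))⁻¹, qPoch_succ (q ^ n)⁻¹, h, qPoch_succ' (M * q ^ (n + 1)),
    qPoch_succ (M * q ^ (n + 1 + 1)), hM]
  simp only [pow_succ, pow_mul, pow_zero, mul_pow]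
  field_simp
  ring

lemma qRacahRaise_mul_coeff_sub {q α β γ δ : ℂ} (hq : q ≠ 0) (n j : ℕ)
    (h2 : 1 - α * β * q ^ (2 * n + 2) ≠ 0) :
    qRacahRaise q α β γ δ n *
        (qRacahCoeff q (α * β) (n + 1) (j + 1) - qRacahCoeff q (α * β) n (j + 1)) =
      -(q ^ (n + 1))⁻¹ * (1 - q ^ (j + 1)) * (1 - α * β * q ^ (n + 1) * q ^ j) *
          ((1 - α * q ^ (n + 1)) * (1 - β * δ * q ^ (n + 1)) * (1 - γ * q ^ (n + 1))) /
          (1 - α * β * q ^ (2 * n + 1)) * qRacahCoeff q (α * β) n j := by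
  have h : (1 - α * β * q ^ (n + 1)) * qPoch (α * β * q ^ (n + 2)) q j =
      qPoch (α * β * q ^ (n + 1)) q j * (1 - α * β * q ^ (n + 1) * q ^ j) := by
    rw [← qPoch_succ, qPoch_succ', mul_assoc _ _ q, ← pow_succ q (n + 1)]
  rw [qRacahCoeff_succ_sub hq, qRacahRaise, qRacahCoeff, mul_comm (1 - α * β * q ^ (2 * n + 1)),
    ← div_div, div_mul_eq_mul_div, div_mul_eq_mul_div, div_mul_eq_mul_div]
  congr 1
  rw [div_eq_iff h2]
  linear_combination (-(q ^ (n + 1))⁻¹ * (1 - q ^ (j + 1)) * (1 - α * β * q ^ (2 * n + 2)) *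
    ((1 - α * q ^ (n + 1)) * (1 - β * δ * q ^ (n + 1)) * (1 - γ * q ^ (n + 1))) *
    qPoch (q ^ n)⁻¹ q j) * h

lemma qRacahLower_mul_coeff_sub {q α β γ δ : ℂ} (hq : q ≠ 0) (n j : ℕ)
    (h2 : n ≠ 0 → 1 - α * β * q ^ (2 * n) ≠ 0) :
    qRacahLower q α β γ δ n *
        (qRacahCoeff q (α * β) (n - 1) (j + 1) - qRacahCoeff q (α * β) n (j + 1)) =
      -q * (1 - q ^ (j + 1)) * (1 - (q ^ n)⁻¹ * q ^ j) *
          ((1 - β * q ^ n) * (γ - α * β * q ^ n) * (δ - α * q ^ n)) /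
          (1 - α * β * q ^ (2 * n + 1)) * qRacahCoeff q (α * β) n j := by
  rcases n with _ | n
  · rcases j with _ | j
    · simp
    · have h : qPoch 1 q (j + 1) = 0 := by rw [qPoch_succ']; simp
      simp [qRacahCoeff, h]
  · have h2' := h2 (Nat.succ_ne_zero n)
    have hqn := pow_ne_zero (n + 1) hq
    have h : (1 - (q ^ (n + 1))⁻¹) * qPoch (q ^ n)⁻¹ q j =
        qPoch (q ^ (n + 1))⁻¹ q j * (1 - (q ^ (n + 1))⁻¹ * q ^ j) := by
      rw [← qPoch_succ, qPoch_succ']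
      congr 2
      rw [pow_succ]; field_simp
    have hn : 1 - q ^ (n + 1) = -q ^ (n + 1) * (1 - (q ^ (n + 1))⁻¹) := by
      field_simp; ring
    rw [Nat.add_sub_cancel, ← neg_sub, qRacahCoeff_succ_sub hq, qRacahLower, qRacahCoeff,
      ← div_div, div_mul_eq_mul_div, div_mul_eq_mul_div, div_mul_eq_mul_div]
    congr 1
    rw [div_eq_iff h2', hn]
    have hc : q ^ (n + 1) * (q ^ (n + 1))⁻¹ = 1 := mul_inv_cancel₀ hqn
    have he : q ^ (2 * n + 2) = q ^ (2 * (n + 1)) := by ring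
    rw [he]
    have h' : (1 - (q ^ (n + 1))⁻¹) * qPoch (q ^ n)⁻¹ q j * (q ^ (n + 1) * (q ^ (n + 1))⁻¹) =
        qPoch (q ^ (n + 1))⁻¹ q j * (1 - (q ^ (n + 1))⁻¹ * q ^ j) := by rw [hc, mul_one, h]
    generalize 1 - α * β * q ^ (2 * (n + 1)) = Z
    linear_combination (-q * (1 - q ^ (j + 1)) * Z *
      ((1 - β * q ^ (n + 1)) * (γ - α * β * q ^ (n + 1)) * (δ - α * q ^ (n + 1))) *
      qPoch (α * β * q ^ (n + 2)) q j) * h'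

lemma qRacahBasis_succ {q α β γ δ : ℂ} (hq : q ≠ 0) (s : ℤ) (k : ℕ)
    (hα : qPoch (α * q) q (k + 1) ≠ 0) (hβ : qPoch (β * δ * q) q (k + 1) ≠ 0)
    (hγ : qPoch (γ * q) q (k + 1) ≠ 0) (h1 : qPoch q q (k + 1) ≠ 0) :
    (1 - α * q ^ (k + 1)) * (1 - β * δ * q ^ (k + 1)) * (1 - γ * q ^ (k + 1)) *
        (1 - q ^ (k + 1)) * qRacahBasis q α β γ δ s (k + 1) =
      q * (1 + δ * γ * q ^ (2 * k + 1) - q ^ k * qLat q γ δ s) * qRacahBasis q α β γ δ s k := by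
  have hs : q ^ (-s) * q ^ (s + 1) = q := by
    rw [← zpow_add₀ hq]; simp
  have hx : (1 - q ^ (-s) * q ^ k) * (1 - δ * γ * q ^ (s + 1) * q ^ k) =
      1 + δ * γ * q ^ (2 * k + 1) - q ^ k * qLat q γ δ s := by
    rw [qLat]
    linear_combination (δ * γ * (q ^ k) ^ 2) * hs
  have e (a : ℂ) : a * q * q ^ k = a * q ^ (k + 1) := by ring
  have e1 : q * q ^ k = q ^ (k + 1) := by ring
  rw [qPoch_succ, e] at hα hβ hγ
  rw [qPoch_succ, e1] at h1
  rw [← hx]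
  simp only [qRacahBasis, qPoch_succ, e, e1]
  obtain ⟨a1, a2⟩ := mul_ne_zero_iff.1 hα
  obtain ⟨b1, b2⟩ := mul_ne_zero_iff.1 hβ
  obtain ⟨c1, c2⟩ := mul_ne_zero_iff.1 hγ
  obtain ⟨d1, d2⟩ := mul_ne_zero_iff.1 h1
  clear hx e e1 hα hβ hγ h1
  generalize qPoch (α * q) q k = a at *
  generalize qPoch (β * δ * q) q k = b at *
  generalize qPoch (γ * q) q k = c at *
  generalize qPoch q q k = d at *
  generalize 1 - α * q ^ (k + 1) = a' at *
  generalize 1 - β * δ * q ^ (k + 1) = b' at *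
  generalize 1 - γ * q ^ (k + 1) = c' at *
  generalize 1 - q ^ (k + 1) = d' at *
  rw [pow_succ q k]
  field_simp

lemma qRacah_coeff_identity {q α β γ δ X Y : ℂ} (hq : q ≠ 0) (hX : X ≠ 0) (hY : Y ≠ 0)
    (h1 : 1 - α * β * (Y ^ 2 * q) ≠ 0) :
    ((X * q)⁻¹ * (1 - X * q) * (1 - δ * γ * (X * q ^ 2))) *
          ((1 - Y⁻¹ * X) * (1 - α * β * (Y * q) * X)) -
        X⁻¹ * q⁻¹ * ((1 - α * (X * q)) * (1 - β * δ * (X * q)) * (1 - γ * (X * q)) *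
          (1 - X * q)) =
      -(Y * q)⁻¹ * (1 - X * q) * (1 - α * β * (Y * q) * X) *
          ((1 - α * (Y * q)) * (1 - β * δ * (Y * q)) * (1 - γ * (Y * q))) /
          (1 - α * β * (Y ^ 2 * q)) +
        -q * (1 - X * q) * (1 - Y⁻¹ * X) *
          ((1 - β * Y) * (γ - α * β * Y) * (δ - α * Y)) / (1 - α * β * (Y ^ 2 * q)) := by
  obtain ⟨D, hD⟩ : ∃ D, D = 1 - α * β * (Y ^ 2 * q) := ⟨_, rfl⟩
  rw [← hD] at h1 ⊢
  field_simp
  rw [hD]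
  ring

/-- Partial sums of the three-term recurrence telescope. -/
lemma qRacah_partial_sum {q α β γ δ : ℂ} (hq : q ≠ 0) (n m : ℕ) (s : ℤ)
    (hpoch : ∀ k ≤ m, qPoch (α * q) q k ≠ 0 ∧ qPoch (β * δ * q) q k ≠ 0 ∧
      qPoch (γ * q) q k ≠ 0 ∧ qPoch q q k ≠ 0)
    (h0 : n ≠ 0 → 1 - α * β * q ^ (2 * n) ≠ 0) (h1 : 1 - α * β * q ^ (2 * n + 1) ≠ 0)
    (h2 : 1 - α * β * q ^ (2 * n + 2) ≠ 0) :
    ∑ k ∈ Finset.range (m + 1),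
        ((qLat q γ δ s - (1 + δ * γ * q)) * qRacahCoeff q (α * β) n k -
          qRacahRaise q α β γ δ n *
            (qRacahCoeff q (α * β) (n + 1) k - qRacahCoeff q (α * β) n k) -
          qRacahLower q α β γ δ n *
            (qRacahCoeff q (α * β) (n - 1) k - qRacahCoeff q (α * β) n k)) *
          qRacahBasis q α β γ δ s k =
      -(q ^ m)⁻¹ * (1 + δ * γ * q ^ (2 * m + 1) - q ^ m * qLat q γ δ s) *
        qRacahCoeff q (α * β) n m * qRacahBasis q α β γ δ s m := by
  induction m with
  | zero =>
    simp [qRacahCoeff_zero]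
  | succ j ih =>
    rw [Finset.sum_range_succ, ih fun k hk => hpoch k (hk.trans j.le_succ),
      qRacahRaise_mul_coeff_sub hq n j h2, qRacahLower_mul_coeff_sub hq n j h0,
      qRacahCoeff_succ]
    obtain ⟨a, b, c, d⟩ := hpoch (j + 1) le_rfl
    have hb := qRacahBasis_succ (α := α) (β := β) (γ := γ) (δ := δ) hq s j a b c d
    have hid := qRacah_coeff_identity (α := α) (β := β) (γ := γ) (δ := δ) hq
      (pow_ne_zero j hq) (pow_ne_zero n hq)
      (by rw [← pow_mul, mul_comm n 2, ← pow_succ]; exact h1)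
    have e1 : q ^ (j + 1) = q ^ j * q := pow_succ q j
    have e2 : q ^ (n + 1) = q ^ n * q := pow_succ q n
    have e3 : q ^ (2 * n + 1) = (q ^ n) ^ 2 * q := by ring
    have e4 : q ^ (2 * j + 1) = (q ^ j) ^ 2 * q := by ring
    have e5 : q ^ (2 * (j + 1) + 1) = (q ^ j) ^ 2 * q ^ 3 := by ring
    rw [e1] at hb
    rw [e4] at hb
    rw [e1, e2, e3, e4, e5]
    have hX := pow_ne_zero j hq
    generalize qRacahBasis q α β γ δ s (j + 1) = V at *
    generalize qRacahBasis q α β γ δ s j = U at *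
    generalize qRacahCoeff q (α * β) n j = E at *
    generalize qLat q γ δ s = x at *
    generalize q ^ j = X at *
    have hXi : X⁻¹ * X = 1 := inv_mul_cancel₀ hX
    have hqi : q⁻¹ * q = 1 := inv_mul_cancel₀ hq
    have hb' : X⁻¹ * ((1 + δ * γ * (X ^ 2 * q) - X * x) * U) = X⁻¹ * q⁻¹ * ((1 - α * (X * q)) *
        (1 - β * δ * (X * q)) * (1 - γ * (X * q)) * (1 - X * q) * V) := by
      rw [hb]; field_simp
    have hx : (X * q)⁻¹ * (1 + δ * γ * (X ^ 2 * q ^ 3) - X * q * x) =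
        (X * q)⁻¹ * (1 - X * q) * (1 - δ * γ * (X * q ^ 2)) - (x - (1 + δ * γ * q)) := by
      field_simp; ring
    linear_combination (-E) * hb' + (E * V) * hid + (E * V) *
      ((1 - (q ^ n)⁻¹ * X) * (1 - α * β * (q ^ n * q) * X)) * hx

lemma qRacahSum_eq_sum_range {q α β γ δ : ℂ} (hq : q ≠ 0) {n m : ℕ} (hnm : n < m) (s : ℤ) :
    qRacahSum q α β γ δ n s =
      ∑ k ∈ Finset.range m, qRacahCoeff q (α * β) n k * qRacahBasis q α β γ δ s k := by
  rw [qRacahSum]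
  have h (d : ℕ) : qRacahCoeff q (α * β) n (n + 1 + d) = 0 := by
    induction d with
    | zero => exact qRacahCoeff_eq_zero hq _ n
    | succ d ih => rw [← add_assoc, qRacahCoeff_succ, ih, zero_mul]
  refine Finset.sum_subset (Finset.range_mono hnm) fun k _ hk => ?_
  obtain ⟨d, rfl⟩ := Nat.exists_eq_add_of_le (not_lt.1 (mt Finset.mem_range.2 hk))
  rw [h, zero_mul]

lemma qRacahSum_recurrence {q α β γ δ : ℂ} (hq : q ≠ 0) (n : ℕ) (s : ℤ)
    (hpoch : ∀ k ≤ n + 1, qPoch (α * q) q k ≠ 0 ∧ qPoch (β * δ * q) q k ≠ 0 ∧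
      qPoch (γ * q) q k ≠ 0 ∧ qPoch q q k ≠ 0)
    (h0 : n ≠ 0 → 1 - α * β * q ^ (2 * n) ≠ 0) (h1 : 1 - α * β * q ^ (2 * n + 1) ≠ 0)
    (h2 : 1 - α * β * q ^ (2 * n + 2) ≠ 0) :
    (qLat q γ δ s - (1 + δ * γ * q)) * qRacahSum q α β γ δ n s =
      qRacahRaise q α β γ δ n * (qRacahSum q α β γ δ (n + 1) s - qRacahSum q α β γ δ n s) +
        qRacahLower q α β γ δ n *
          (qRacahSum q α β γ δ (n - 1) s - qRacahSum q α β γ δ n s) := by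
  have h := qRacah_partial_sum hq n (n + 1) s hpoch h0 h1 h2
  rw [qRacahCoeff_eq_zero hq, mul_zero, zero_mul] at h
  rw [qRacahSum_eq_sum_range hq (show n < n + 2 by omega),
    qRacahSum_eq_sum_range hq (show n + 1 < n + 2 by omega),
    qRacahSum_eq_sum_range hq (show n - 1 < n + 2 by omega), ← sub_eq_zero, ← h]
  simp only [← Finset.sum_sub_distrib, Finset.mul_sum, ← Finset.sum_add_distrib]
  exact Finset.sum_congr rfl fun k _ => by ring

lemma qPoch_shift_degree (q M : ℂ) (n : ℕ) :
    (1 - M * q ^ (n + 1)) * qPoch (M * q ^ (n + 2)) q (n + 1) =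
      qPoch (M * q ^ (n + 1)) q n * ((1 - M * q ^ (2 * n + 1)) * (1 - M * q ^ (2 * n + 2))) := by
  have h := qPoch_succ' (M * q ^ (n + 1)) q (n + 1)
  rw [qPoch_succ, qPoch_succ, mul_assoc M _ q, ← pow_succ] at h
  rw [← h]
  ring

lemma qRacahPrefactor_succ {q α β γ δ : ℂ} (n : ℕ)
    (hn : qPoch (α * β * q ^ (n + 1)) q n ≠ 0) (hn' : qPoch (α * β * q ^ (n + 2)) q (n + 1) ≠ 0)
    (h1 : 1 - α * β * q ^ (2 * n + 1) ≠ 0) (h2 : 1 - α * β * q ^ (2 * n + 2) ≠ 0) :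
    qRacahPrefactor q α β γ δ (n + 1) =
      qRacahRaise q α β γ δ n * qRacahPrefactor q α β γ δ n := by
  have h := qPoch_shift_degree q (α * β) n
  rw [qRacahPrefactor, qRacahPrefactor, qRacahRaise, div_mul_div_comm,
    div_eq_div_iff hn' (by positivity)]
  simp only [qPoch_succ (α * q), qPoch_succ (β * δ * q), qPoch_succ (γ * q)]
  linear_combination (-(qPoch (α * q) q n * qPoch (β * δ * q) q n * qPoch (γ * q) q n *
    ((1 - α * q ^ (n + 1)) * (1 - β * δ * q ^ (n + 1)) * (1 - γ * q ^ (n + 1))))) * h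

lemma qRacahNormSq_zero {q α β γ δ : ℂ} (h : 1 - α * β * q ≠ 0) :
    qRacahNormSq q α β γ δ 0 = 1 := by
  simp [qRacahNormSq, qPoch_zero, h]

lemma qRacahNormSq_succ {q α β γ δ : ℂ} (hγ : γ ≠ 0) (hδ : δ ≠ 0) (n : ℕ)
    (hn : qPoch (α * β * q ^ (n + 1)) q n ≠ 0) (hn' : qPoch (α * β * q ^ (n + 2)) q (n + 1) ≠ 0)
    (hαβ : qPoch (α * β * q) q (n + 1) ≠ 0)
    (h1 : 1 - α * β * q ^ (2 * n + 1) ≠ 0) (h2 : 1 - α * β * q ^ (2 * n + 2) ≠ 0)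
    (h3 : 1 - α * β * q ^ (2 * n + 3) ≠ 0) :
    qRacahNormSq q α β γ δ (n + 1) =
      qRacahRaise q α β γ δ n * qRacahLower q α β γ δ (n + 1) * qRacahNormSq q α β γ δ n := by
  have h := qPoch_shift_degree q (α * β) n
  have z1 : q ^ (((n + 1 : ℕ) : ℤ) + 1) = q ^ (n + 2) := by norm_cast
  have z2 : q ^ ((n : ℤ) + 1) = q ^ (n + 1) := by norm_cast
  have z3 : q ^ (2 * ((n + 1 : ℕ) : ℤ) + 1) = q ^ (2 * n + 3) := by norm_cast
  have z4 : q ^ (2 * (n : ℤ) + 1) = q ^ (2 * n + 1) := by norm_cast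
  simp only [qRacahNormSq, qRacahRaise, qRacahLower, z1, z2, z3, z4]
  have hQ : qPoch (α * β * q ^ (n + 1)) q n = (1 - α * β * q ^ (n + 1)) *
      qPoch (α * β * q ^ (n + 2)) q (n + 1) /
        ((1 - α * β * q ^ (2 * n + 1)) * (1 - α * β * q ^ (2 * n + 2))) := by
    rw [h]; field_simp
  have hM : 1 - α * β * q ^ (n + 1) ≠ 0 := by
    intro h0
    rw [h0, zero_mul, zero_div] at hQ
    exact hn hQ
  rw [qPoch_succ] at hαβ
  have hαβ' := left_ne_zero_of_mul hαβ
  rw [hQ]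
  generalize qPoch (α * β * q ^ (n + 2)) q (n + 1) = Q at *
  simp only [qPoch_succ]
  have e (a : ℂ) : a * q * q ^ n = a * q ^ (n + 1) := by ring
  have e0 : q * q ^ n = q ^ (n + 1) := by ring
  have e2 : 2 * (n + 1) = 2 * n + 2 := by ring
  have e3 : 2 * (n + 1) + 1 = 2 * n + 3 := by ring
  have e5 : (1 - q * α * β * γ⁻¹ * q ^ n) = (γ - α * β * q ^ (n + 1)) / γ := by
    field_simp; ring
  have e6 : (1 - α * δ⁻¹ * q * q ^ n) = (δ - α * q ^ (n + 1)) / δ := by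
    field_simp; ring
  rw [e5, e6, pow_succ (δ * γ * q) n]
  simp only [e, e0, e3]
  simp only [e2]
  clear e e0 e2 e3 e5 e6 z1 z2 z3 z4 hQ hn h hαβ
  generalize 1 - α * β * q ^ (2 * n + 1) = Z₁ at *
  generalize 1 - α * β * q ^ (2 * n + 2) = Z₂ at *
  generalize 1 - α * β * q ^ (2 * n + 3) = Z₃ at *
  generalize 1 - α * β * q ^ (n + 1) = Z at *
  generalize 1 - α * β * q = Z₀ at *
  generalize qPoch (α * β * q) q n = P₀ at *
  generalize qPoch (α * q) q n = P₁ at *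
  generalize qPoch (β * δ * q) q n = P₂ at *
  generalize qPoch (γ * q) q n = P₃ at *
  generalize qPoch q q n = P₄ at *
  generalize qPoch (q * α * β * γ⁻¹) q n = P₅ at *
  generalize qPoch (α * δ⁻¹ * q) q n = P₆ at *
  generalize qPoch (β * q) q n = P₇ at *
  generalize (δ * γ * q) ^ n = D at *
  have hprod : P₁ * (1 - α * q ^ (n + 1)) * (P₂ * (1 - β * δ * q ^ (n + 1))) *
      (P₃ * (1 - γ * q ^ (n + 1))) * (P₄ * (1 - q ^ (n + 1))) *
      (P₅ * ((γ - α * β * q ^ (n + 1)) / γ)) * (P₆ * ((δ - α * q ^ (n + 1)) / δ)) *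
      (P₇ * (1 - β * q ^ (n + 1))) =
      P₁ * P₂ * P₃ * P₄ * P₅ * P₆ * P₇ * ((1 - α * q ^ (n + 1)) * (1 - β * δ * q ^ (n + 1)) *
        (1 - γ * q ^ (n + 1)) * ((1 - q ^ (n + 1)) * (1 - β * q ^ (n + 1)) *
        (γ - α * β * q ^ (n + 1)) * (δ - α * q ^ (n + 1)))) / (γ * δ) := by
    ring
  have hraise : (1 - α * q ^ (n + 1)) * Z * (1 - β * δ * q ^ (n + 1)) * (1 - γ * q ^ (n + 1)) =
      (1 - α * q ^ (n + 1)) * (1 - β * δ * q ^ (n + 1)) * (1 - γ * q ^ (n + 1)) * Z := by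
    ring
  have hlower : q * (1 - q ^ (n + 1)) * (1 - β * q ^ (n + 1)) * (γ - α * β * q ^ (n + 1)) *
      (δ - α * q ^ (n + 1)) = q * ((1 - q ^ (n + 1)) * (1 - β * q ^ (n + 1)) *
        (γ - α * β * q ^ (n + 1)) * (δ - α * q ^ (n + 1))) := by
    ring
  rw [hprod, hraise, hlower]
  clear hprod hraise hlower
  generalize P₁ * P₂ * P₃ * P₄ * P₅ * P₆ * P₇ = P
  generalize (1 - α * q ^ (n + 1)) * (1 - β * δ * q ^ (n + 1)) * (1 - γ * q ^ (n + 1)) = F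
  generalize (1 - q ^ (n + 1)) * (1 - β * q ^ (n + 1)) * (γ - α * β * q ^ (n + 1)) *
    (δ - α * q ^ (n + 1)) = G
  field_simp

lemma qRacah_recurrence {q α β γ δ : ℂ} (hq : q ≠ 0) (n : ℕ) (s : ℤ)
    (hpoch : ∀ k ≤ n + 1, qPoch (α * q) q k ≠ 0 ∧ qPoch (β * δ * q) q k ≠ 0 ∧
      qPoch (γ * q) q k ≠ 0 ∧ qPoch q q k ≠ 0)
    (hpoch2 : ∀ k ≤ n + 1, qPoch (α * β * q ^ (k + 1)) q k ≠ 0)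
    (hodd : ∀ k ≤ n + 1, 1 - α * β * q ^ (2 * k + 1) ≠ 0)
    (heven : ∀ k ≤ n, 1 - α * β * q ^ (2 * k + 2) ≠ 0) :
    qLat q γ δ s * qRacah q α β γ δ n s =
      qRacah q α β γ δ (n + 1) s +
        (1 + δ * γ * q - qRacahRaise q α β γ δ n - qRacahLower q α β γ δ n) *
          qRacah q α β γ δ n s +
        qRacahRaise q α β γ δ (n - 1) * qRacahLower q α β γ δ n *
          qRacah q α β γ δ (n - 1) s := by
  have hrec := qRacahSum_recurrence hq n s hpoch
    (fun h => by obtain ⟨k, rfl⟩ := Nat.exists_eq_succ_of_ne_zero h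
                 exact heven k (Nat.le_succ k))
    (hodd n n.le_succ) (heven n le_rfl)
  have hP : qRacahLower q α β γ δ n * qRacahPrefactor q α β γ δ n = qRacahLower q α β γ δ n *
      (qRacahRaise q α β γ δ (n - 1) * qRacahPrefactor q α β γ δ (n - 1)) := by
    rcases n with _ | n
    · simp [qRacahLower]
    · rw [Nat.add_sub_cancel, qRacahPrefactor_succ n (hpoch2 n (by omega))
        (hpoch2 (n + 1) (by omega)) (hodd n (by omega)) (heven n (by omega))]
  simp only [qRacah_eq_prefactor_mul_sum]
  rw [qRacahPrefactor_succ n (hpoch2 n (by omega)) (hpoch2 (n + 1) le_rfl) (hodd n n.le_succ)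
    (heven n le_rfl)]
  linear_combination qRacahPrefactor q α β γ δ n * hrec + qRacahSum q α β γ δ (n - 1) s * hP

/-- The Christoffel–Darboux formula for the `q`-Racah polynomials. -/
lemma qRacah_christoffel_darboux {q α β γ δ : ℂ} (hq : q ≠ 0) (hγ : γ ≠ 0) (hδ : δ ≠ 0)
    (n : ℕ) (s t : ℤ)
    (hpoch : ∀ k ≤ n + 1, qPoch (α * q) q k ≠ 0 ∧ qPoch (β * δ * q) q k ≠ 0 ∧
      qPoch (γ * q) q k ≠ 0 ∧ qPoch q q k ≠ 0)
    (hpoch2 : ∀ k ≤ n + 1, qPoch (α * β * q ^ (k + 1)) q k ≠ 0)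
    (hαβ : ∀ k ≤ n + 1, qPoch (α * β * q) q k ≠ 0)
    (hodd : ∀ k ≤ n + 1, 1 - α * β * q ^ (2 * k + 1) ≠ 0)
    (heven : ∀ k ≤ n, 1 - α * β * q ^ (2 * k + 2) ≠ 0)
    (hnorm : ∀ k ≤ n, qRacahNormSq q α β γ δ k ≠ 0) :
    (qLat q γ δ s - qLat q γ δ t) * qKer q α β γ δ (n + 1) s t =
      (qRacah q α β γ δ (n + 1) s * qRacah q α β γ δ n t -
        qRacah q α β γ δ n s * qRacah q α β γ δ (n + 1) t) / qRacahNormSq q α β γ δ n := by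
  induction n with
  | zero =>
    have hs := qRacah_recurrence hq 0 s hpoch hpoch2 hodd heven
    have ht := qRacah_recurrence hq 0 t hpoch hpoch2 hodd heven
    have h0 := hodd 0 (Nat.zero_le _)
    have hL : qRacahLower q α β γ δ 0 = 0 := by simp [qRacahLower]
    rw [hL] at hs ht
    rw [qRacahNormSq_zero (by simpa using h0)]
    simp only [qKer, zero_add, Finset.sum_range_one, div_one] at *
    rw [qRacahNormSq_zero (by simpa using h0)]
    linear_combination qRacah q α β γ δ 0 t * hs - qRacah q α β γ δ 0 s * ht
  | succ n ih =>
    have hs := qRacah_recurrence hq (n + 1) s hpoch hpoch2 hodd heven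
    have ht := qRacah_recurrence hq (n + 1) t hpoch hpoch2 hodd heven
    have ih' := ih (fun k hk => hpoch k (by omega)) (fun k hk => hpoch2 k (by omega))
      (fun k hk => hαβ k (by omega)) (fun k hk => hodd k (by omega))
      (fun k hk => heven k (by omega)) (fun k hk => hnorm k (by omega))
    have hd := qRacahNormSq_succ hγ hδ n (hpoch2 n (by omega)) (hpoch2 (n + 1) (by omega))
      (hαβ (n + 1) (by omega)) (hodd n (by omega)) (heven n (by omega))
      (hodd (n + 1) (by omega))
    have hn := hnorm n (by omega)
    have hn' := hnorm (n + 1) le_rfl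
    rw [Nat.add_sub_cancel] at hs ht
    rw [qKer, Finset.sum_range_succ, ← qKer, mul_add, ih', div_add' _ _ _ hn,
      div_eq_div_iff hn hn', mul_div_assoc']
    rw [← mul_assoc, ← sub_eq_zero]
    field_simp
    rw [hd]
    linear_combination (qRacahNormSq q α β γ δ n * qRacah q α β γ δ (n + 1) t) * hs -
      (qRacahNormSq q α β γ δ n * qRacah q α β γ δ (n + 1) s) * ht

lemma qLat_sub {q : ℂ} (hq : q ≠ 0) (γ δ : ℂ) (s t : ℤ) :
    qLat q γ δ s - qLat q γ δ t =
      (q ^ (-s) - q ^ (-t)) * (1 - δ * γ * q ^ (t + 1) * q ^ s) := by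
  have h1 : q ^ (-s) * q ^ s = 1 := by rw [← zpow_add₀ hq]; simp
  have h2 : q ^ (-t) * q ^ t = 1 := by rw [← zpow_add₀ hq]; simp
  simp only [qLat, zpow_add₀ hq, zpow_one]
  linear_combination (δ * γ * q ^ t * q) * h1 - (δ * γ * q ^ s * q) * h2

/-- the second representation formula
`φ(s) R_n^{A,B}(s) = A(s,n) R_n(s) + B(s,n) R_{n-1}(s)`. -/
theorem qRacahKrall_second_representation
    (q : ℝ) (hq0 : 0 < q) (hq1 : q < 1) (α β γ δ : ℂ) (N : ℕ)
    (htrunc : α * (q : ℂ) = (q : ℂ) ^ (-(N : ℤ)) ∨ β * δ * (q : ℂ) = (q : ℂ) ^ (-(N : ℤ)) ∨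
      γ * (q : ℂ) = (q : ℂ) ^ (-(N : ℤ)))
    (hpoch : ∀ k : ℕ, k ≤ N → qPoch (α * (q : ℂ)) (q : ℂ) k ≠ 0 ∧
      qPoch (β * δ * (q : ℂ)) (q : ℂ) k ≠ 0 ∧ qPoch (γ * (q : ℂ)) (q : ℂ) k ≠ 0 ∧
      qPoch (q : ℂ) (q : ℂ) k ≠ 0)
    (hpoch2 : ∀ k : ℕ, k ≤ N → qPoch (α * β * (q : ℂ) ^ ((k : ℤ) + 1)) (q : ℂ) k ≠ 0)
    (hnorm : ∀ k : ℕ, k ≤ N → qRacahNormSq (q : ℂ) α β γ δ k ≠ 0)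
    (n : ℕ) (hn1 : 1 ≤ n) (hnN : n ≤ N)
    (A B : ℂ)
    (hκ : qKappa (q : ℂ) α β γ δ A B n 0 (N : ℤ) ≠ 0)
    (s : ℤ) :
    qPhi (q : ℂ) γ δ N s * qRacahKrall (q : ℂ) α β γ δ A B N n s =
      qRepA (q : ℂ) α β γ δ A B N n s * qRacah (q : ℂ) α β γ δ n s +
        qRepB (q : ℂ) α β γ δ A B N n s * qRacah (q : ℂ) α β γ δ (n - 1) s := by
  have hq : (q : ℂ) ≠ 0 := by exact_mod_cast hq0.ne'
  generalize (q : ℂ) = Q at *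
  have hodd : ∀ k ≤ N, 1 - α * β * Q ^ (2 * k + 1) ≠ 0 := fun k hk h0 => by
    have z : Q ^ (2 * (k : ℤ) + 1) = Q ^ (2 * k + 1) := by norm_cast
    exact hnorm k hk (by simp [qRacahNormSq, z, h0])
  have hpoch2' : ∀ k ≤ N, qPoch (α * β * Q ^ (k + 1)) Q k ≠ 0 := fun k hk => by
    have z : Q ^ ((k : ℤ) + 1) = Q ^ (k + 1) := by norm_cast
    exact z ▸ hpoch2 k hk
  have heven : ∀ k, k + 1 ≤ N → 1 - α * β * Q ^ (2 * k + 2) ≠ 0 := fun k hk h0 => by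
    refine hpoch2' (k + 1) hk ?_
    rw [qPoch_succ, show 1 - α * β * Q ^ (k + 1 + 1) * Q ^ k = 1 - α * β * Q ^ (2 * k + 2) by ring,
      h0, mul_zero]
  have hαβ : ∀ k ≤ N, qPoch (α * β * Q) Q k ≠ 0 := fun k hk h0 =>
    hnorm k hk (by simp [qRacahNormSq, h0])
  have hγδ : δ * γ ≠ 0 := fun h0 =>
    hnorm 1 (hn1.trans hnN) (by simp [qRacahNormSq, h0])
  obtain ⟨m, rfl⟩ := Nat.exists_eq_add_of_le' hn1
  have hCD (t : ℤ) := qRacah_christoffel_darboux hq (right_ne_zero_of_mul hγδ)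
    (left_ne_zero_of_mul hγδ) m s t (fun k hk => hpoch k (hk.trans hnN))
    (fun k hk => hpoch2' k (hk.trans hnN)) (fun k hk => hαβ k (hk.trans hnN))
    (fun k hk => hodd k (hk.trans hnN)) (fun k hk => heven k (by omega))
    (fun k hk => hnorm k (by omega))
  have h0 := hCD 0
  have hN := hCD N
  rw [qLat_sub hq] at h0 hN
  have e0 : Q ^ ((0 : ℤ) + 1) * Q ^ s = Q ^ (s + 1) := by
    rw [← zpow_add₀ hq]; congr 1; ring
  rw [mul_assoc (δ * γ) (Q ^ ((0 : ℤ) + 1)), e0, neg_zero, zpow_zero] at h0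
  simp only [qRacahKrall, qRepA, qRepB, qPhi, Nat.add_sub_cancel]
  linear_combination
    (-(A * qKrall0 Q α β γ δ A B N (m + 1) * ((Q ^ (-s) - Q ^ (-(N : ℤ))) *
      (1 - δ * γ * Q ^ ((N : ℤ) + 1) * Q ^ s)))) * h0 -
    (B * qKrallN Q α β γ δ A B N (m + 1) * ((1 - δ * γ * Q ^ (s + 1)) * (Q ^ (-s) - 1))) * hN
end
end

section
/- For every integer n with 1 ≤ n ≤ N there exists a polynomial P of degree at most n+2 (in one variable, with complex coefficients) such that φ(s) R_n^{α,β,A,B}(s)_q = P(x(s)) for all s, where φ(s) = (1 − δγq^{N+1}q^s)(1 − δγq^{s+1})(q^{−s} − 1)(q^{−s} − q^{−N}); that is, φ(s) R_n^{α,β,A,B}(s)_q is a polynomial of degree n+2 in the lattice variable x(s). Moreover φ(s) = (x(s) − x(0))(x(s) − x(N)) is a polynomial of degree 2 in x(s). -/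
open Finset Filter

set_option autoImplicit false

noncomputable section

/-- `f : ℤ → ℂ` agrees with a polynomial of degree at most `m` in the lattice function `x`. -/
def IsPolyIn (x : ℤ → ℂ) (m : ℕ) (f : ℤ → ℂ) : Prop :=
  ∃ P : Polynomial ℂ, P.natDegree ≤ m ∧ ∀ s, f s = P.eval (x s)

namespace IsPolyIn

variable {x f g : ℤ → ℂ} {m k : ℕ}

theorem mono (hf : IsPolyIn x m f) (h : m ≤ k) : IsPolyIn x k f := by
  obtain ⟨P, hP, e⟩ := hf
  exact ⟨P, hP.trans h, e⟩

theorem const (c : ℂ) : IsPolyIn x 0 fun _ => c :=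
  ⟨Polynomial.C c, by simp, by simp⟩

theorem lattice : IsPolyIn x 1 x :=
  ⟨Polynomial.X, by simp, by simp⟩

theorem mul (hf : IsPolyIn x m f) (hg : IsPolyIn x k g) :
    IsPolyIn x (m + k) fun s => f s * g s := by
  obtain ⟨P, hP, eP⟩ := hf
  obtain ⟨Q, hQ, eQ⟩ := hg
  exact ⟨P * Q, Polynomial.natDegree_mul_le_of_le hP hQ, fun s => by simp [eP, eQ]⟩

theorem const_mul (c : ℂ) (hf : IsPolyIn x m f) : IsPolyIn x m fun s => c * f s := by
  simpa using (const c).mul hf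

theorem sub (hf : IsPolyIn x m f) (hg : IsPolyIn x m g) : IsPolyIn x m fun s => f s - g s := by
  obtain ⟨P, hP, eP⟩ := hf
  obtain ⟨Q, hQ, eQ⟩ := hg
  exact ⟨P - Q, (Polynomial.natDegree_sub_le P Q).trans (max_le hP hQ), fun s => by simp [eP, eQ]⟩

theorem sum {ι : Type*} (S : Finset ι) {F : ι → ℤ → ℂ} (h : ∀ i ∈ S, IsPolyIn x m (F i)) :
    IsPolyIn x m fun s => ∑ i ∈ S, F i s := by
  choose! P hP e using h
  refine ⟨∑ i ∈ S, P i, Polynomial.natDegree_sum_le_of_forall_le S P hP, fun s => ?_⟩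
  rw [Polynomial.eval_finsetSum]
  exact Finset.sum_congr rfl fun i hi => e i hi s

end IsPolyIn

theorem isPolyIn_qPoch_mul_qPoch {q : ℂ} (hq : q ≠ 0) (γ δ : ℂ) (k : ℕ) :
    IsPolyIn (qLat q γ δ) k
      fun s => qPoch (q ^ (-s)) q k * qPoch (δ * γ * q ^ (s + 1)) q k := by
  induction k with
  | zero => simpa [qPoch] using IsPolyIn.const (x := qLat q γ δ) 1
  | succ k ih =>
    have hlin : IsPolyIn (qLat q γ δ) 1
        fun s => (1 + δ * γ * q * q ^ k * q ^ k) - q ^ k * qLat q γ δ s :=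
      ((IsPolyIn.const _).mono zero_le_one).sub (IsPolyIn.lattice.const_mul _)
    convert ih.mul hlin using 2 with s
    have hs : q ^ s ≠ 0 := zpow_ne_zero s hq
    simp only [qPoch, Finset.prod_range_succ, qLat, zpow_neg, zpow_add₀ hq, zpow_one]
    field_simp
    ring

theorem isPolyIn_qRacah {q : ℂ} (hq : q ≠ 0) (α β γ δ : ℂ) (n : ℕ) :
    IsPolyIn (qLat q γ δ) n (qRacah q α β γ δ n) := by
  refine (IsPolyIn.sum _ fun k hk => ?_).const_mul _
  convert ((isPolyIn_qPoch_mul_qPoch hq γ δ k).mono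
    (Nat.lt_succ_iff.mp (Finset.mem_range.mp hk))).const_mul
    (qPoch (q ^ (-(n : ℤ))) q k * qPoch (α * β * q ^ ((n : ℤ) + 1)) q k /
      (qPoch (α * q) q k * qPoch (β * δ * q) q k * qPoch (γ * q) q k * qPoch q q k) *
      q ^ k) using 2 with s
  ring

theorem isPolyIn_qKer {q : ℂ} (hq : q ≠ 0) (α β γ δ : ℂ) (n : ℕ) (t : ℤ) :
    IsPolyIn (qLat q γ δ) n fun s => qKer q α β γ δ n s t := by
  refine IsPolyIn.sum _ fun k hk => ?_
  convert ((isPolyIn_qRacah hq α β γ δ k).mono (Finset.mem_range.mp hk).le).const_mul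
    (qRacah q α β γ δ k t / qRacahNormSq q α β γ δ k) using 2 with s
  ring

theorem isPolyIn_qRacahKrall {q : ℂ} (hq : q ≠ 0) (α β γ δ A B : ℂ) (N n : ℕ) :
    IsPolyIn (qLat q γ δ) n (qRacahKrall q α β γ δ A B N n) :=
  ((isPolyIn_qRacah hq α β γ δ n).sub ((isPolyIn_qKer hq α β γ δ n 0).const_mul _)).sub
    ((isPolyIn_qKer hq α β γ δ n N).const_mul _)

theorem qPhi_eq_mul {q : ℂ} (hq : q ≠ 0) (γ δ : ℂ) (N : ℕ) (s : ℤ) :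
    qPhi q γ δ N s =
      (qLat q γ δ s - qLat q γ δ 0) * (qLat q γ δ s - qLat q γ δ (N : ℤ)) := by
  have hs : q ^ s ≠ 0 := zpow_ne_zero s hq
  simp only [qPhi, qLat, zpow_neg, zpow_add₀ hq, zpow_one, zpow_zero, zpow_natCast]
  field_simp
  ring

theorem isPolyIn_qPhi {q : ℂ} (hq : q ≠ 0) (γ δ : ℂ) (N : ℕ) :
    IsPolyIn (qLat q γ δ) 2 (qPhi q γ δ N) := by
  have hlin (c : ℂ) : IsPolyIn (qLat q γ δ) 1 fun s => qLat q γ δ s - c :=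
    IsPolyIn.lattice.sub ((IsPolyIn.const c).mono zero_le_one)
  exact funext (qPhi_eq_mul hq γ δ N) ▸ (hlin _).mul (hlin _)

/-- `φ(s) R_n^{α,β,A,B}(s)_q` is a polynomial of degree at most `n+2` in the
lattice variable `x(s)`, and `φ(s) = (x(s) - x(0))(x(s) - x(N))` is of degree 2 in `x(s)`. -/
theorem qPhi_mul_qRacahKrall_is_polynomial
    (q : ℝ) (hq0 : 0 < q) (hq1 : q < 1) (α β γ δ : ℂ) (N : ℕ)
    (htrunc : α * (q : ℂ) = (q : ℂ) ^ (-(N : ℤ)) ∨ β * δ * (q : ℂ) = (q : ℂ) ^ (-(N : ℤ)) ∨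
      γ * (q : ℂ) = (q : ℂ) ^ (-(N : ℤ)))
    (hpoch : ∀ k : ℕ, k ≤ N → qPoch (α * (q : ℂ)) (q : ℂ) k ≠ 0 ∧
      qPoch (β * δ * (q : ℂ)) (q : ℂ) k ≠ 0 ∧ qPoch (γ * (q : ℂ)) (q : ℂ) k ≠ 0 ∧
      qPoch (q : ℂ) (q : ℂ) k ≠ 0)
    (hpoch2 : ∀ k : ℕ, k ≤ N → qPoch (α * β * (q : ℂ) ^ ((k : ℤ) + 1)) (q : ℂ) k ≠ 0)
    (hnorm : ∀ k : ℕ, k ≤ N → qRacahNormSq (q : ℂ) α β γ δ k ≠ 0)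
    (n : ℕ) (hn1 : 1 ≤ n) (hnN : n ≤ N)
    (A B : ℂ)
    (hκ : qKappa (q : ℂ) α β γ δ A B n 0 (N : ℤ) ≠ 0) :
    (∃ P : Polynomial ℂ, P.natDegree ≤ n + 2 ∧
      ∀ s : ℤ, qPhi (q : ℂ) γ δ N s * qRacahKrall (q : ℂ) α β γ δ A B N n s =
        P.eval (qLat (q : ℂ) γ δ s)) ∧
      ∀ s : ℤ, qPhi (q : ℂ) γ δ N s =
        (qLat (q : ℂ) γ δ s - qLat (q : ℂ) γ δ 0) *
          (qLat (q : ℂ) γ δ s - qLat (q : ℂ) γ δ (N : ℤ)) := by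
  have hq : (q : ℂ) ≠ 0 := Complex.ofReal_ne_zero.mpr hq0.ne'
  refine ⟨?_, qPhi_eq_mul hq γ δ N⟩
  exact ((isPolyIn_qPhi hq γ δ N).mul (isPolyIn_qRacahKrall hq α β γ δ A B N n)).mono
    (Nat.add_comm 2 n).le
end
end
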